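/- The first singular homology group with integer coefficients H_1(A; ℤ) of the Hawaiian earring A is uncountable. -/

import Mathlib

/-- The Hawaiian earring: the union of the circles of center `1/n` and radius `1/n`
in the complex plane `ℂ ≅ ℝ²`, for `n ≥ 1`. -/
def hawaiian : Set ℂ := ⋃ n ∈ {n : ℕ | 0 < n}, Metric.sphere ((n : ℂ))⁻¹ ((n : ℝ))⁻¹

namespace HawaiianAux

open Complex Topology Filter

/-- Bump collapsing function `ℂ → ℂ`, retracting the earring on its `N`-th circle. -/
noncomputable def rfun (N : ℕ) (z : ℂ) : ℂ :=
  1 - N * z * ((max 0 (1 - |2 * (z⁻¹).re - N|) : ℝ) : ℂ)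

lemma mem_iff {z : ℂ} : z ∈ hawaiian ↔ ∃ k : ℕ, 0 < k ∧ ‖z - (k : ℂ)⁻¹‖ = (k : ℝ)⁻¹ := by
  simp [hawaiian, dist_eq_norm]

lemma two_re_inv {k : ℕ} (hk : 0 < k) {z : ℂ} (hz : z ≠ 0)
    (h : ‖z - (k : ℂ)⁻¹‖ = (k : ℝ)⁻¹) : 2 * (z⁻¹).re = k := by
  have hk' : (k : ℝ) ≠ 0 := by positivity
  have h2 : normSq (z - (k : ℂ)⁻¹) = ((k : ℝ)⁻¹) ^ 2 := by
    rw [normSq_eq_norm_sq, h]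
  have h3 : ((k : ℂ)⁻¹) = (((k : ℝ)⁻¹ : ℝ) : ℂ) := by push_cast; rfl
  rw [h3, normSq_apply] at h2
  simp only [sub_re, sub_im, ofReal_re, ofReal_im, sub_zero] at h2
  have h4 : normSq z ≠ 0 := by simpa using hz
  rw [inv_re]
  rw [normSq_apply] at *
  field_simp at h2 ⊢
  have : (k:ℝ) * (2 * z.re - k * (z.re * z.re + z.im * z.im)) = 0 := by nlinarith
  rcases mul_eq_zero.1 this with h | h
  · exact absurd h hk'
  · rw [← sq, ← sq] at h h4
    rw [div_eq_iff h4]; linarith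

lemma rfun_eq (N : ℕ) {k : ℕ} (hk : 0 < k) {z : ℂ}
    (h : ‖z - (k : ℂ)⁻¹‖ = (k : ℝ)⁻¹) : rfun N z = if k = N then 1 - N * z else 1 := by
  by_cases hz : z = 0
  · subst hz; simp [rfun]
  rw [rfun, two_re_inv hk hz h]
  split_ifs with hkN
  · subst hkN; simp
  · have : (1 : ℝ) ≤ |(k : ℝ) - N| := by
      have h1 : (1 : ℤ) ≤ |(k : ℤ) - N| := Int.one_le_abs (by omega)
      exact_mod_cast h1
    rw [max_eq_left (by linarith)]; simp

lemma rfun_norm (N : ℕ) {z : ℂ} (h : z ∈ hawaiian) : ‖rfun N z‖ = 1 := by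
  obtain ⟨k, hk, h⟩ := mem_iff.1 h
  rw [rfun_eq N hk h]
  split_ifs with hkN
  · subst hkN
    have hk' : (k : ℂ) ≠ 0 := by exact_mod_cast hk.ne'
    have : (1 - k * z : ℂ) = -(k * (z - (k : ℂ)⁻¹)) := by field_simp; ring
    rw [this, norm_neg, norm_mul, h]
    have hk' : (k : ℝ) ≠ 0 := by exact_mod_cast hk.ne'
    simp [hk']
  · simp

lemma rfun_cont (N : ℕ) : Continuous (rfun N) := by
  rw [continuous_iff_continuousAt]
  intro z
  by_cases hz : z = 0
  · subst hz
    unfold rfun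
    refine ContinuousAt.sub continuousAt_const ?_
    rw [ContinuousAt]
    simp only [mul_zero, zero_mul]
    refine squeeze_zero_norm (a := fun z : ℂ => N * ‖z‖) (fun z => ?_) ?_
    · rw [norm_mul, norm_mul, norm_real, Real.norm_eq_abs, abs_of_nonneg (le_max_left _ _)]
      have : max 0 (1 - |2 * (z⁻¹).re - N|) ≤ 1 :=
        max_le zero_le_one (by linarith [abs_nonneg (2 * (z⁻¹).re - N)])
      have h2 : ‖(N : ℂ)‖ * ‖z‖ = N * ‖z‖ := by simp
      rw [h2]
      exact mul_le_of_le_one_right (by positivity) this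
    · have : Continuous fun z : ℂ => (N : ℝ) * ‖z‖ := by fun_prop
      simpa using this.tendsto 0
  · have hi : ContinuousAt (fun z : ℂ => z⁻¹) z := continuousAt_inv₀ hz
    have hre : ContinuousAt (fun z : ℂ => (z⁻¹).re) z :=
      continuous_re.continuousAt.comp hi
    have hb : ContinuousAt (fun z : ℂ => max 0 (1 - |2 * (z⁻¹).re - N|)) z := by fun_prop
    have hb' := continuous_ofReal.continuousAt.comp hb
    exact continuousAt_const.sub ((continuousAt_const.mul continuousAt_id).mul hb')

/-- The collapse of the earring on its `N`-th circle. -/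
noncomputable def rmap (N : ℕ) : C(hawaiian, Circle) where
  toFun z := ⟨rfun N z, mem_sphere_zero_iff_norm.2 (rfun_norm N z.2)⟩
  continuous_toFun := Continuous.subtype_mk ((rfun_cont N).comp continuous_subtype_val) _

open Classical in
/-- Coefficients of the loop attached to a set of indices. -/
noncomputable def coef (S : Set ℕ) (k : ℕ) : ℂ := if k - 1 ∈ S then (k : ℂ)⁻¹ else 0

/-- The loop running through the circles `n + 1` for `n` in `S`. -/
noncomputable def loop (S : Set ℕ) (u : ℝ) : ℂ :=
  coef S ⌊u⌋₊ * (1 - exp (2 * Real.pi * I * u))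

lemma coef_norm (S : Set ℕ) (k : ℕ) : ‖coef S k‖ ≤ (k : ℝ)⁻¹ := by
  unfold coef; split_ifs <;> simp

lemma coef_norm' (S : Set ℕ) (k : ℕ) : ‖coef S k‖ ≤ 1 :=
  (coef_norm S k).trans (Nat.cast_inv_le_one k)

lemma exp_norm (u : ℝ) : ‖exp (2 * Real.pi * I * u)‖ = 1 := by
  have : (2 * Real.pi * I * u : ℂ) = ((2 * Real.pi * u : ℝ) : ℂ) * I := by push_cast; ring
  rw [this, norm_exp_ofReal_mul_I]

lemma exp_nat (k : ℕ) : exp (2 * Real.pi * I * (k : ℝ)) = 1 := by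
  have := exp_nat_mul_two_pi_mul_I k
  rw [← this]; congr 1; push_cast; ring

lemma zero_mem : (0 : ℂ) ∈ hawaiian := mem_iff.2 ⟨1, one_pos, by simp⟩

lemma loop_circle (S : Set ℕ) {u : ℝ} (hu : 0 < ⌊u⌋₊) :
    ‖loop S u - ((⌊u⌋₊ : ℕ) : ℂ)⁻¹‖ = ((⌊u⌋₊ : ℕ) : ℝ)⁻¹ := by
  unfold loop coef
  split_ifs
  · have (a b : ℂ) : a * (1 - b) - a = -(a * b) := by ring
    rw [this, norm_neg, norm_mul, exp_norm]; simp
  · simp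

lemma loop_mem (S : Set ℕ) (u : ℝ) : loop S u ∈ hawaiian := by
  by_cases hu : 0 < ⌊u⌋₊
  · exact mem_iff.2 ⟨_, hu, loop_circle S hu⟩
  · have : ⌊u⌋₊ = 0 := by omega
    have : loop S u = 0 := by simp [loop, this, coef]
    rw [this]; exact zero_mem

lemma loop_cont (S : Set ℕ) {u : ℝ} (hu : 0 ≤ u) : ContinuousAt (loop S) u := by
  have hc : Continuous fun u : ℝ => 1 - exp (2 * Real.pi * I * u) := by fun_prop
  by_cases h : (⌊u⌋₊ : ℝ) = u
  · have h0 : 1 - exp (2 * Real.pi * I * u) = 0 := by rw [← h, exp_nat]; simp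
    have h1 : loop S u = 0 := by rw [loop, h0, mul_zero]
    rw [ContinuousAt, h1]
    refine squeeze_zero_norm (a := fun u : ℝ => ‖1 - exp (2 * Real.pi * I * u)‖) (fun v => ?_) ?_
    · rw [loop, norm_mul]
      exact mul_le_of_le_one_left (norm_nonneg _) (coef_norm' _ _)
    · have := hc.norm.tendsto u
      rwa [h0, norm_zero] at this
  · have h1 : (⌊u⌋₊ : ℝ) < u := lt_of_le_of_ne (Nat.floor_le hu) h
    have h2 : Set.Ioo (⌊u⌋₊ : ℝ) (⌊u⌋₊ + 1) ∈ 𝓝 u := Ioo_mem_nhds h1 (Nat.lt_floor_add_one u)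
    have h3 : (fun v : ℝ => coef S ⌊u⌋₊ * (1 - exp (2 * Real.pi * I * v))) =ᶠ[𝓝 u] loop S := by
      filter_upwards [h2] with v hv
      have : ⌊v⌋₊ = ⌊u⌋₊ := by
        rw [Nat.floor_eq_iff ((Nat.cast_nonneg _).trans hv.1.le)]
        exact ⟨hv.1.le, hv.2⟩
      rw [loop, this]
    exact (continuousAt_const.mul hc.continuousAt).congr h3

lemma loop_bound (S : Set ℕ) {t : ℝ} (h0 : 0 ≤ t) (h1 : t ≤ 1) : ‖loop S t⁻¹‖ ≤ 4 * t := by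
  rcases h0.eq_or_lt with h0 | h0
  · subst h0; simp [loop]
  have hu : 1 ≤ t⁻¹ := (one_le_inv₀ h0).2 h1
  have hf : 1 ≤ ⌊t⁻¹⌋₊ := Nat.one_le_floor_iff _ |>.2 hu
  have hf' : (1 : ℝ) ≤ ⌊t⁻¹⌋₊ := by exact_mod_cast hf
  have h2 : ((⌊t⁻¹⌋₊ : ℕ) : ℝ)⁻¹ ≤ 2 * t := by
    have h3 := Nat.lt_floor_add_one t⁻¹
    have h4 : t⁻¹ / 2 ≤ ⌊t⁻¹⌋₊ := by linarith
    have h5 := inv_anti₀ (by positivity) h4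
    rw [inv_div, div_inv_eq_mul] at h5
    exact h5
  have h3 : ‖1 - exp (2 * Real.pi * I * (t⁻¹ : ℝ))‖ ≤ 2 := by
    refine (norm_sub_le _ _).trans ?_
    rw [exp_norm]; norm_num
  rw [loop, norm_mul]
  calc _ ≤ (2 * t) * 2 := mul_le_mul ((coef_norm _ _).trans h2) h3 (norm_nonneg _) (by positivity)
    _ = _ := by ring

lemma loop_contI (S : Set ℕ) : Continuous fun t : unitInterval => loop S (t : ℝ)⁻¹ := by
  rw [continuous_iff_continuousAt]
  intro t
  by_cases ht : (t : ℝ) = 0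
  · have : loop S (t : ℝ)⁻¹ = 0 := by simp [ht, loop]
    rw [ContinuousAt, this]
    refine squeeze_zero_norm (a := fun t : unitInterval => 4 * (t : ℝ))
      (fun s => loop_bound S s.2.1 s.2.2) ?_
    have h : Continuous fun t : unitInterval => 4 * (t : ℝ) := by fun_prop
    have := h.tendsto t
    rwa [ht, mul_zero] at this
  · have h1 : ContinuousAt (fun t : unitInterval => (t : ℝ)⁻¹) t :=
      continuous_subtype_val.continuousAt.inv₀ ht
    exact ContinuousAt.comp (f := fun t : unitInterval => (t : ℝ)⁻¹) (loop_cont S (inv_nonneg.2 t.2.1)) h1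

/-- The loop as a path in the earring. -/
noncomputable def lpath (S : Set ℕ) (a : hawaiian) (ha : (a : ℂ) = 0) : Path a a where
  toFun t := ⟨loop S (t : ℝ)⁻¹, loop_mem _ _⟩
  continuous_toFun := (loop_contI S).subtype_mk _
  source' := Subtype.ext (by simp [ha, loop])
  target' := Subtype.ext (by
    have := exp_nat 1
    simp only [Nat.cast_one, ofReal_one] at this
    simp [ha, loop, this])

lemma rfun_loop_not_mem {S : Set ℕ} {n : ℕ} (hn : n ∉ S) (u : ℝ) :
    rfun (n + 1) (loop S u) = 1 := by
  by_cases hu : 0 < ⌊u⌋₊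
  · rw [rfun_eq _ hu (loop_circle S hu)]
    split_ifs with h
    · simp [loop, h, coef, hn]
    · rfl
  · have : ⌊u⌋₊ = 0 := by omega
    have : loop S u = 0 := by simp [loop, this, coef]
    simp [this, rfun]

lemma rfun_loop_mem {S : Set ℕ} {n : ℕ} (hn : n ∈ S) (u : ℝ) (hu : u = 0 ∨ 1 ≤ u) :
    rfun (n + 1) (loop S u) =
      if ⌊u⌋₊ = n + 1 then exp (2 * Real.pi * I * u) else 1 := by
  rcases hu with rfl | hu
  · simp [loop, rfun]
  have hu : 0 < ⌊u⌋₊ := Nat.one_le_floor_iff _ |>.2 hu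
  rw [rfun_eq _ hu (loop_circle S hu)]
  split_ifs with h
  · have : ((n : ℂ) + 1) ≠ 0 := by exact_mod_cast n.succ_ne_zero
    simp [loop, h, coef, hn]
    field_simp
    ring
  · rfl

/-- The real lift of the loop. -/
noncomputable def lift (n : ℕ) (t : ℝ) : ℝ :=
  2 * Real.pi * (max ((n + 2 : ℕ) : ℝ)⁻¹ (min ((n + 1 : ℕ) : ℝ)⁻¹ t))⁻¹

lemma lift_cont (n : ℕ) : Continuous (lift n) := by
  unfold lift
  refine continuous_const.mul (Continuous.inv₀ (by fun_prop) fun t => ?_)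
  have : (0 : ℝ) < ((n + 2 : ℕ) : ℝ)⁻¹ := by positivity
  exact (lt_max_of_lt_left this).ne'

lemma lift_zero (n : ℕ) : lift n 0 = 2 * Real.pi * (n + 2 : ℕ) := by
  unfold lift
  rw [min_eq_right (by positivity), max_eq_left (by positivity), inv_inv]

lemma inv_le' (n : ℕ) : ((n + 2 : ℕ) : ℝ)⁻¹ ≤ ((n + 1 : ℕ) : ℝ)⁻¹ :=
  inv_anti₀ (by positivity) (by push_cast; linarith)

lemma lift_one (n : ℕ) : lift n 1 = 2 * Real.pi * (n + 1 : ℕ) := by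
  unfold lift
  rw [min_eq_left (Nat.cast_inv_le_one _), max_eq_right (inv_le' n), inv_inv]

lemma lift_exp (n : ℕ) {t : ℝ} (h0 : 0 ≤ t) :
    exp (lift n t * I) = if ⌊t⁻¹⌋₊ = n + 1 then exp (2 * Real.pi * I * (t⁻¹ : ℝ)) else 1 := by
  have key (m : ℕ) (h : lift n t = 2 * Real.pi * m) : exp (lift n t * I) = 1 := by
    rw [h, ← exp_nat m]; congr 1; push_cast; ring
  rcases h0.eq_or_lt with h0 | h0
  · subst h0
    rw [key _ (lift_zero n)]; simp
  rcases le_or_gt t ((n + 2 : ℕ) : ℝ)⁻¹ with h1 | h1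
  · rw [key (n + 2), if_neg]
    · rw [le_inv_comm₀ h0 (by positivity)] at h1
      have := Nat.le_floor h1
      omega
    · unfold lift
      rw [min_eq_right (h1.trans (inv_le' n)), max_eq_left h1, inv_inv]
  have h1' := (inv_lt_comm₀ (by positivity) h0).1 h1
  rcases le_or_gt t ((n + 1 : ℕ) : ℝ)⁻¹ with h2 | h2
  · have h2' := (le_inv_comm₀ h0 (by positivity)).1 h2
    rw [if_pos]
    · unfold lift
      rw [min_eq_right h2, max_eq_right h1.le]
      congr 1; push_cast; ring
    · rw [Nat.floor_eq_iff (by positivity)]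
      refine ⟨h2', h1'.trans_le (by push_cast; linarith)⟩
  · rw [key (n + 1), if_neg]
    · have h2' := (inv_lt_comm₀ (by positivity) h0).1 h2
      have := (Nat.floor_lt (by positivity)).2 h2'
      omega
    · unfold lift
      rw [min_eq_left h2.le, max_eq_right (inv_le' n), inv_inv]

lemma rmap_base (N : ℕ) (a : hawaiian) (ha : (a : ℂ) = 0) : rmap N a = 1 :=
  Subtype.ext (by
    change rfun N a = 1
    simp [ha, rfun])

/-- A point of the fibre. -/
noncomputable def base (n : ℕ) (a : hawaiian) (ha : (a : ℂ) = 0) :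
    Circle.exp ⁻¹' {rmap (n + 1) a} :=
  ⟨lift n 0, by
    rw [Set.mem_preimage, rmap_base _ a ha, Set.mem_singleton_iff]
    apply Subtype.ext
    have := lift_exp n le_rfl
    simpa using this⟩

/-- Winding number around the `(n+1)`-st circle. -/
noncomputable def wind (n : ℕ) (a : hawaiian) (ha : (a : ℂ) = 0) :=
  (Circle.isAddQuotientCoveringMap_exp.fundamentalGroupToMulOpposite (base n a ha)).comp
    (FundamentalGroup.map (rmap (n + 1)) a)

/-- The class of the loop. -/
noncomputable def cls (S : Set ℕ) (a : hawaiian) (ha : (a : ℂ) = 0) : FundamentalGroup hawaiian a :=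
  FundamentalGroup.fromPath (Path.Homotopic.Quotient.mk (lpath S a ha))

lemma wind_eq_one_iff (n : ℕ) (a : hawaiian) (ha : (a : ℂ) = 0) (S : Set ℕ) :
    wind n a ha (cls S a ha) = 1 ↔ n ∉ S := by
  rw [wind, MonoidHom.comp_apply,
    IsAddQuotientCoveringMap.fundamentalGroupToMulOpposite_eq_one_iff]
  have hs : ((lpath S a ha).map (rmap (n + 1)).continuous) 0 = Circle.exp (base n a ha).1 := by
    rw [Path.source]; exact (base n a ha).2.symm
  have key : FundamentalGroup.map (rmap (n + 1)) a (cls S a ha) =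
    Path.Homotopic.Quotient.mk ((lpath S a ha).map (rmap (n + 1)).continuous) := rfl
  have key2 : (Circle.isAddQuotientCoveringMap_exp.isCoveringMap.monodromy
      (FundamentalGroup.map (rmap (n + 1)) a (cls S a ha)) (base n a ha)).1 =
      Circle.isAddQuotientCoveringMap_exp.isCoveringMap.liftPath
        ((lpath S a ha).map (rmap (n + 1)).continuous) (base n a ha).1 hs 1 := rfl
  rw [← Subtype.coe_inj]
  erw [key2]
  by_cases hn : n ∈ S
  · have : (fun t : unitInterval => lift n t) = Circle.isAddQuotientCoveringMap_exp.isCoveringMap.liftPath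
        ((lpath S a ha).map (rmap (n + 1)).continuous) (base n a ha).1 hs := by
      rw [IsCoveringMap.eq_liftPath_iff]
      refine ⟨(lift_cont n).comp continuous_subtype_val, ?_, by simp [base]⟩
      funext t
      apply Subtype.ext
      have h1 : ((t : ℝ)⁻¹ = 0) ∨ 1 ≤ (t : ℝ)⁻¹ := by
        rcases t.2.1.eq_or_lt with h | h
        · left; rw [← h]; simp
        · right; exact (one_le_inv₀ h).2 t.2.2
      exact (lift_exp n t.2.1).trans (rfun_loop_mem hn _ h1).symm
    rw [← this]
    simp only [hn, not_true_eq_false, iff_false]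
    have hp := Real.pi_pos
    have h1 := lift_one n
    have h0 := lift_zero n
    intro h
    have h' : lift n 1 = lift n 0 := h
    rw [h1, h0] at h'
    push_cast at h'
    nlinarith
  · have : (fun t : unitInterval => lift n 0) = Circle.isAddQuotientCoveringMap_exp.isCoveringMap.liftPath
        ((lpath S a ha).map (rmap (n + 1)).continuous) (base n a ha).1 hs := by
      rw [IsCoveringMap.eq_liftPath_iff]
      refine ⟨continuous_const, ?_, rfl⟩
      funext t
      apply Subtype.ext
      have := lift_exp n le_rfl
      simp at this
      refine Eq.trans ?_ (rfun_loop_not_mem hn _).symm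
      simpa using this
    rw [← this]
    simp [hn, base]

end HawaiianAux

/-- The first singular homology group of the path-connected Hawaiian earring,
realized as the abelianization of its fundamental group (based at the distinguished
point `0`), is uncountable. -/
theorem stmt_17 (a : hawaiian) (ha : (a : ℂ) = 0) :
    ¬ Countable (Abelianization (FundamentalGroup hawaiian a)) := by
  intro hc
  have hinj : Function.Injective
      (fun S : Set ℕ => Abelianization.of (HawaiianAux.cls S a ha)) := by
    intro S T h
    ext n
    have h2 := congrArg (Abelianization.lift (HawaiianAux.wind n a ha)) h
    simp only [Abelianization.lift_apply_of] at h2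
    have hS := HawaiianAux.wind_eq_one_iff n a ha S
    have hT := HawaiianAux.wind_eq_one_iff n a ha T
    rw [h2] at hS
    exact not_iff_not.1 (hS.symm.trans hT)
  have : Countable (Set ℕ) := hinj.countable
  obtain ⟨g, hg⟩ := this.exists_injective_nat
  exact Function.cantor_injective g hg
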